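/- There exist R real coefficients ω_j > 0 and exponents α_j > 0 such that sup_{λ∈[1,M]} |1/λ − Σ_{j=1}^R ω_j exp(−α_j λ)| ≤ 16 exp(−R π² / log(8M)), for every M > 1 and R ∈ ℕ. -/

import Mathlib

open Finset


theorem BH_rolle (g g' : ℝ → ℝ) (hg : ∀ x, HasDerivAt g (g' x) x) (Z : Finset ℝ) :
    (∀ z ∈ Z, g z = 0) → ∃ Z' : Finset ℝ, Z.card ≤ Z'.card + 1 ∧
      ∀ z ∈ Z', g' z = 0 ∧ z ∉ Z ∧ ∃ m ∈ Z, z < m := by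
  induction Z using Finset.induction_on_max with
  | empty => intro _; exact ⟨∅, by simp, by simp⟩
  | insert a Z ha ih =>
    intro hz
    obtain ⟨Z', hc, hZ'⟩ := ih (fun z h => hz z (Finset.mem_insert_of_mem h))
    have haZ : a ∉ Z := fun h => lt_irrefl _ (ha a h)
    by_cases hne : Z.Nonempty
    · set b := Z.max' hne
      have hb : b ∈ Z := Z.max'_mem hne
      obtain ⟨c, hc1, hc2⟩ := exists_hasDerivAt_eq_zero (f := g) (f' := g') (ha b hb)
        (fun x _ => (hg x).continuousAt.continuousWithinAt)
        (by rw [hz b (Finset.mem_insert_of_mem hb), hz a (Finset.mem_insert_self _ _)])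
        (fun x _ => hg x)
      have hlt : ∀ m ∈ Z, m < c := fun m hm => lt_of_le_of_lt (Z.le_max' m hm) hc1.1
      refine ⟨insert c Z', ?_, ?_⟩
      · have : c ∉ Z' := by
          intro h
          obtain ⟨_, _, m, hm, h2⟩ := hZ' c h
          exact lt_asymm h2 (hlt m hm)
        rw [Finset.card_insert_of_notMem this, Finset.card_insert_of_notMem haZ]
        omega
      · intro z hz'
        rcases Finset.mem_insert.1 hz' with rfl | h
        · refine ⟨hc2, ?_, a, Finset.mem_insert_self _ _, hc1.2⟩
          intro h
          rcases Finset.mem_insert.1 h with h | h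
          · exact absurd hc1.2 (by rw [h]; exact lt_irrefl _)
          · exact lt_irrefl _ (hlt _ h)
        · obtain ⟨h1, h2, m, hm, h3⟩ := hZ' z h
          refine ⟨h1, ?_, m, Finset.mem_insert_of_mem hm, h3⟩
          intro h'
          rcases Finset.mem_insert.1 h' with h' | h'
          · have := ha m hm
            linarith
          · exact h2 h'
    · rw [Finset.not_nonempty_iff_eq_empty] at hne
      subst hne
      exact ⟨∅, by simp, by simp⟩

theorem BH_expPoly_zeros (s : Finset ℝ) : ∀ c : ℝ → ℝ, (∃ d ∈ s, c d ≠ 0) → ∀ Z : Finset ℝ,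
    (∀ z ∈ Z, ∑ d ∈ s, c d * Real.exp (-d * z) = 0) → Z.card < s.card := by
  induction s using Finset.induction_on with
  | empty => intro c ⟨d, hd, _⟩; simp at hd
  | insert a s ha ih =>
    intro c hc Z hZ
    rw [Finset.card_insert_of_notMem ha]
    by_cases h : ∃ d ∈ s, c d ≠ 0
    · have hg : ∀ x, HasDerivAt (fun z => ∑ d ∈ insert a s, c d * Real.exp ((a - d) * z))
          (∑ d ∈ insert a s, c d * (Real.exp ((a - d) * x) * ((a - d) * 1))) x := by
        intro x
        apply HasDerivAt.fun_sum
        intro d _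
        exact (((hasDerivAt_id x).const_mul (a - d)).exp).const_mul (c d)
      obtain ⟨Z', h1, h2⟩ := BH_rolle _ _ hg Z (by
        intro z hz
        have := hZ z hz
        calc ∑ d ∈ insert a s, c d * Real.exp ((a - d) * z)
            = Real.exp (a * z) * ∑ d ∈ insert a s, c d * Real.exp (-d * z) := by
              rw [Finset.mul_sum]
              refine Finset.sum_congr rfl fun d _ => ?_
              rw [mul_left_comm, ← Real.exp_add]
              ring_nf
          _ = 0 := by rw [this, mul_zero])
      have := ih (fun d => c d * (a - d)) (by
        obtain ⟨d, hd, h⟩ := h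
        refine ⟨d, hd, mul_ne_zero h (sub_ne_zero.2 ?_)⟩
        rintro rfl
        exact ha hd) Z' (by
        intro z hz
        have := (h2 z hz).1
        rw [Finset.sum_insert ha] at this
        simp only [sub_self, zero_mul, mul_zero, zero_add, mul_one] at this
        have h3 : Real.exp (a * z) * ∑ d ∈ s, c d * (a - d) * Real.exp (-d * z) = 0 := by
          rw [← this, Finset.mul_sum]
          refine Finset.sum_congr rfl fun d _ => ?_
          rw [show (a - d) * z = a * z + -d * z by ring, Real.exp_add]
          ring
        exact (mul_eq_zero.1 h3).resolve_left (Real.exp_pos _).ne')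
      omega
    · push Not at h
      have hca : c a ≠ 0 := by
        obtain ⟨d, hd, h'⟩ := hc
        rcases Finset.mem_insert.1 hd with rfl | hd
        · exact h'
        · exact absurd (h d hd) h'
      have : Z = ∅ := by
        apply Finset.eq_empty_of_forall_notMem
        intro z hz
        have := hZ z hz
        rw [Finset.sum_insert ha, Finset.sum_eq_zero (fun d hd => by rw [h d hd, zero_mul]),
          add_zero] at this
        exact (mul_ne_zero hca (Real.exp_pos _).ne') this
      rw [this]; simp

/-- The exponential sum with parameters `p = (w, a)`. -/
noncomputable def BHphi {κ : Type*} [Fintype κ] (τ d : ℝ) (p : (κ → ℝ) × (κ → ℝ)) : ℝ :=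
  ∑ k, p.1 k ^ 2 * Real.exp (-(τ + p.2 k ^ 2) * d)

theorem BHphi_contDiff {κ : Type*} [Fintype κ] (τ d : ℝ) :
    ContDiff ℝ 1 (BHphi (κ := κ) τ d) := by
  unfold BHphi
  fun_prop

theorem BHphi_line {κ : Type*} [Fintype κ] (τ d : ℝ) (w a v b : κ → ℝ) :
    HasDerivAt (fun t : ℝ => BHphi τ d (w + t • v, a + t • b))
      (∑ k, (2 * w k * v k * Real.exp (-(τ + a k ^ 2) * d) +
        w k ^ 2 * (Real.exp (-(τ + a k ^ 2) * d) * (-(2 * a k * b k) * d)))) 0 := by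
  unfold BHphi
  apply HasDerivAt.fun_sum
  intro k _
  have h1 : HasDerivAt (fun t : ℝ => (w + t • v) k) (v k) 0 := by
    have := ((hasDerivAt_id (0:ℝ)).mul_const (v k)).const_add (w k)
    simpa using this
  have h2 : HasDerivAt (fun t : ℝ => (a + t • b) k) (b k) 0 := by
    have := ((hasDerivAt_id (0:ℝ)).mul_const (b k)).const_add (a k)
    simpa using this
  have h3 := (h1.pow 2).mul (((((h2.pow 2).const_add τ).neg).mul_const d).exp)
  refine h3.congr_deriv ?_
  simp

theorem BH_lagrange {κ ι : Type*} [Fintype κ] [Fintype ι] (τ : ℝ) (d : ι → ℝ)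
    (w a : κ → ℝ)
    (hmin : ∀ p : (κ → ℝ) × (κ → ℝ), (∀ i, BHphi τ (d i) p = BHphi τ (d i) (w, a)) →
      BHphi τ 0 (w, a) ≤ BHphi τ 0 p) :
    ∃ (Λ : ι → ℝ) (Λ₀ : ℝ), (Λ, Λ₀) ≠ 0 ∧ ∀ k, w k ≠ 0 →
      (∑ i, Λ i * Real.exp (-(τ + a k ^ 2) * d i) + Λ₀ = 0 ∧
       (a k ≠ 0 → ∑ i, Λ i * d i * Real.exp (-(τ + a k ^ 2) * d i) = 0)) := by
  classical
  have hs : ∀ e : ℝ, HasStrictFDerivAt (BHphi (κ := κ) τ e) (fderiv ℝ (BHphi τ e) (w, a)) (w, a) :=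
    fun e => (BHphi_contDiff τ e).contDiffAt.hasStrictFDerivAt (by simp)
  have hext : IsLocalExtrOn (BHphi (κ := κ) τ 0)
      {p | ∀ i, (fun i => BHphi (κ := κ) τ (d i)) i p = (fun i => BHphi (κ := κ) τ (d i)) i (w, a)}
      (w, a) := by
    left
    have : IsMinOn (BHphi (κ := κ) τ 0) {p | ∀ i, BHphi (κ := κ) τ (d i) p = BHphi (κ := κ) τ (d i) (w, a)} (w, a) :=
      fun p hp => hmin p hp
    exact this.localize
  obtain ⟨Λ, Λ₀, h0, hsum⟩ := hext.exists_multipliers_of_hasStrictFDerivAt (fun i => hs (d i)) (hs 0)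
  have key : ∀ v b : κ → ℝ, ∀ e : ℝ, fderiv ℝ (BHphi τ e) (w, a) (v, b) =
      (∑ k, (2 * w k * v k * Real.exp (-(τ + a k ^ 2) * e) +
        w k ^ 2 * (Real.exp (-(τ + a k ^ 2) * e) * (-(2 * a k * b k) * e)))) := by
    intro v b e
    have hl : HasDerivAt (fun t : ℝ => ((w + t • v, a + t • b) : (κ → ℝ) × (κ → ℝ))) (v, b) 0 := by
      have h1 := ((hasDerivAt_id (0:ℝ)).smul_const v).const_add w
      have h2 := ((hasDerivAt_id (0:ℝ)).smul_const b).const_add a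
      have := h1.prodMk h2
      simpa using this
    have h4 : HasFDerivAt (BHphi (κ := κ) τ e) (fderiv ℝ (BHphi τ e) (w, a))
        ((fun t : ℝ => ((w + t • v, a + t • b) : (κ → ℝ) × (κ → ℝ))) 0) := by
      simpa using (hs e).hasFDerivAt
    have := h4.comp_hasDerivAt (0:ℝ) hl
    exact this.unique (BHphi_line τ e w a v b)
  refine ⟨Λ, Λ₀, h0, fun k hk => ⟨?_, fun hak => ?_⟩⟩
  · have := congrArg (fun L => L (Pi.single k 1, 0)) hsum
    simp only [add_apply, _root_.sum_apply, smul_apply, key, smul_eq_mul, zero_apply] at this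
    simp [Pi.single_apply] at this
    have h5 : (2 * w k) * (∑ i, Λ i * Real.exp (-(τ + a k ^ 2) * d i) + Λ₀) = 0 := by
      rw [← this, mul_add, Finset.mul_sum]
      congr 1
      · refine Finset.sum_congr rfl fun i _ => ?_
        ring_nf
      · ring
    exact (mul_eq_zero.1 h5).resolve_left (by positivity)
  · have := congrArg (fun L => L (0, Pi.single k 1)) hsum
    simp only [add_apply, _root_.sum_apply, smul_apply, key, smul_eq_mul, zero_apply] at this
    simp [Pi.single_apply] at this
    have h5 : (w k ^ 2 * a k * (-2)) * (∑ i, Λ i * d i * Real.exp (-(τ + a k ^ 2) * d i)) = 0 := by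
      rw [← neg_eq_zero, ← this, Finset.mul_sum, ← Finset.sum_neg_distrib]
      refine Finset.sum_congr rfl fun i _ => ?_
      ring_nf
    exact (mul_eq_zero.1 h5).resolve_left (by positivity)


theorem BH_exists_min {κ ι : Type*} [Fintype κ] [Fintype ι] (τ : ℝ) (d : ι → ℝ)
    (hd : ∀ i, 0 < d i) (p0 : (κ → ℝ) × (κ → ℝ)) :
    ∃ w a : κ → ℝ, (∀ i, BHphi τ (d i) (w, a) = BHphi τ (d i) p0) ∧
      BHphi τ 0 (w, a) ≤ BHphi τ 0 p0 ∧
      ∀ p : (κ → ℝ) × (κ → ℝ), (∀ i, BHphi τ (d i) p = BHphi τ (d i) p0) →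
        BHphi τ 0 (w, a) ≤ BHphi τ 0 p := by
  classical
  set m0 := BHphi τ 0 p0 with hm0
  have hphi0 : ∀ p : (κ → ℝ) × (κ → ℝ), BHphi τ 0 p = ∑ k, p.1 k ^ 2 := by
    intro p; simp [BHphi]
  let C : Set ((κ → ℝ) × (κ → ℝ)) := {q | q ∈ Set.Icc ((0, 0) : (κ → ℝ) × (κ → ℝ))
      (fun _ => m0, fun _ => 1) ∧ ∑ k, q.1 k ≤ m0 ∧
      ∀ i, ∑ k, q.1 k * (Real.exp (-τ * d i) * q.2 k ^ d i) = BHphi τ (d i) p0}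
  have hC : IsCompact C := by
    have hCeq : C = Set.Icc ((0, 0) : (κ → ℝ) × (κ → ℝ)) (fun _ => m0, fun _ => 1) ∩
        ({q | ∑ k, q.1 k ≤ m0} ∩ ⋂ i,
          {q | ∑ k, q.1 k * (Real.exp (-τ * d i) * q.2 k ^ d i) = BHphi τ (d i) p0}) := by
      ext q
      constructor
      · rintro ⟨h1, h2, h3⟩
        exact ⟨h1, h2, Set.mem_iInter.2 h3⟩
      · rintro ⟨h1, h2, h3⟩
        exact ⟨h1, h2, Set.mem_iInter.1 h3⟩
    rw [hCeq]
    apply isCompact_Icc.inter_right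
    apply IsClosed.inter
    · exact isClosed_le (f := fun q : (κ → ℝ) × (κ → ℝ) => ∑ k, q.1 k) (by fun_prop) continuous_const
    · refine isClosed_iInter fun i => ?_
      refine isClosed_eq ?_ continuous_const
      refine continuous_finsetSum _ fun k _ => ?_
      refine Continuous.mul (by fun_prop) (continuous_const.mul ?_)
      exact Continuous.rpow_const (by fun_prop) (fun _ => Or.inr (hd i).le)
  have hmap : ∀ p : (κ → ℝ) × (κ → ℝ), (∀ i, BHphi τ (d i) p = BHphi τ (d i) p0) →
      BHphi τ 0 p ≤ m0 → ((fun k => p.1 k ^ 2, fun k => Real.exp (-(p.2 k ^ 2))) :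
        (κ → ℝ) × (κ → ℝ)) ∈ C := by
    intro p hp hp0
    rw [hphi0] at hp0
    refine ⟨⟨⟨fun k => sq_nonneg _, fun k => (Real.exp_pos _).le⟩,
      ⟨fun k => ?_, fun k => ?_⟩⟩, hp0, fun i => ?_⟩
    · exact le_trans (Finset.single_le_sum (f := fun k => p.1 k ^ 2)
        (fun k _ => sq_nonneg _) (Finset.mem_univ k)) hp0
    · exact Real.exp_le_one_iff.2 (neg_nonpos.2 (sq_nonneg _))
    · rw [← hp i, BHphi]
      refine Finset.sum_congr rfl fun k _ => ?_
      simp only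
      rw [← Real.exp_mul, ← Real.exp_add]
      ring_nf
  obtain ⟨q, hqC, hq⟩ := hC.exists_isMinOn ⟨_, hmap p0 (fun _ => rfl) le_rfl⟩
    (f := fun q : (κ → ℝ) × (κ → ℝ) => ∑ k, q.1 k) (by fun_prop)
  obtain ⟨⟨⟨h1, h2⟩, ⟨h3, h4⟩⟩, h5, h6⟩ := hqC
  have h1' : ∀ k, 0 ≤ q.1 k := fun k => h1 k
  have h2' : ∀ k, 0 ≤ q.2 k := fun k => h2 k
  have h4' : ∀ k, q.2 k ≤ 1 := fun k => h4 k
  set w : κ → ℝ := fun k => if q.2 k = 0 then 0 else √(q.1 k) with hw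
  set a : κ → ℝ := fun k => if q.2 k = 0 then 0 else √(-Real.log (q.2 k)) with ha
  have hle : BHphi τ 0 (w, a) ≤ ∑ k, q.1 k := by
    rw [hphi0]
    refine Finset.sum_le_sum fun k _ => ?_
    by_cases h : q.2 k = 0
    · simp [hw, h, h1' k]
    · simp [hw, h, Real.sq_sqrt (h1' k)]
  refine ⟨w, a, fun i => ?_, hle.trans h5, fun p hp => ?_⟩
  · rw [← h6 i, BHphi]
    refine Finset.sum_congr rfl fun k _ => ?_
    by_cases h : q.2 k = 0
    · simp [hw, h, Real.zero_rpow (hd i).ne']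
    · have hpos : 0 < q.2 k := lt_of_le_of_ne (h2' k) (Ne.symm h)
      simp only [hw, ha, h, if_false]
      rw [Real.sq_sqrt (h1' k), Real.sq_sqrt (neg_nonneg.2 (Real.log_nonpos (h2' k) (h4' k))),
        Real.rpow_def_of_pos hpos, ← Real.exp_add]
      ring_nf
  · by_cases h : BHphi τ 0 p ≤ m0
    · refine hle.trans ?_
      rw [hphi0]
      exact hq (hmap p hp h)
    · exact (hle.trans h5).trans (not_le.1 h).le

theorem BH_reduce {κ : Type*} [Fintype κ] (R : ℕ) (d : Fin (2 * R) → ℝ)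
    (hinj : Function.Injective d) (hd : ∀ i, 0 < d i) (τ : ℝ) (p0 : (κ → ℝ) × (κ → ℝ)) :
    ∃ (S : Finset ℝ) (W : ℝ → ℝ), S.card ≤ R ∧ (∀ s ∈ S, τ ≤ s ∧ 0 < W s) ∧
      (∀ i, ∑ s ∈ S, W s * Real.exp (-s * d i) = BHphi τ (d i) p0) ∧
      ∑ s ∈ S, W s ≤ BHphi τ 0 p0 := by
  classical
  obtain ⟨w, a, hwa, hle, hmin⟩ := BH_exists_min τ d hd p0
  obtain ⟨Λ, Λ₀, hΛ, hk⟩ := BH_lagrange τ d w a (fun p hp => hmin p fun i => (hp i).trans (hwa i))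
  set K : Finset κ := Finset.univ.filter (fun k => w k ≠ 0) with hK
  set α : κ → ℝ := fun k => τ + a k ^ 2 with hα
  set S := K.image α with hS
  set W : ℝ → ℝ := fun s => ∑ k ∈ K with α k = s, w k ^ 2 with hW
  have hsum : ∀ e : ℝ, ∑ s ∈ S, W s * Real.exp (-s * e) = BHphi τ e (w, a) := by
    intro e
    have h1 : BHphi τ e (w, a) = ∑ k ∈ K, w k ^ 2 * Real.exp (-(α k) * e) := by
      rw [BHphi, hK, Finset.sum_filter]
      refine Finset.sum_congr rfl fun k _ => ?_
      by_cases h : w k = 0 <;> simp [h, hα]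
    rw [h1, ← Finset.sum_fiberwise_of_maps_to (g := α) (t := S)
      (fun k hk => Finset.mem_image_of_mem _ hk)]
    refine Finset.sum_congr rfl fun s _ => ?_
    rw [hW, Finset.sum_mul]
    refine Finset.sum_congr rfl fun k hk => ?_
    rw [(Finset.mem_filter.1 hk).2]
  refine ⟨S, W, ?_, ?_, fun i => (hsum _).trans (hwa i), ?_⟩
  · -- cardinality
    have hP0 : ∀ s ∈ S, ∑ i, Λ i * Real.exp (-s * d i) + Λ₀ = 0 := by
      intro s hs
      obtain ⟨k, hkK, rfl⟩ := Finset.mem_image.1 hs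
      exact (hk k (Finset.mem_filter.1 hkK).2).1
    have hP1 : ∀ s ∈ S.erase τ, ∑ i, Λ i * d i * Real.exp (-s * d i) = 0 := by
      intro s hs
      obtain ⟨hne, hs⟩ := Finset.mem_erase.1 hs
      obtain ⟨k, hkK, rfl⟩ := Finset.mem_image.1 hs
      refine (hk k (Finset.mem_filter.1 hkK).2).2 ?_
      intro h
      exact hne (by simp [hα, h])
    by_cases hz : Λ = 0
    · have : S = ∅ := by
        apply Finset.eq_empty_of_forall_notMem
        intro s hs
        have := hP0 s hs
        simp [hz] at this
        exact hΛ (by rw [hz, this]; rfl)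
      simp [this]
    · have hg : ∀ x, HasDerivAt (fun z => ∑ i, Λ i * Real.exp (-z * d i) + Λ₀)
          (∑ i, Λ i * (Real.exp (-x * d i) * (-1 * d i))) x := by
        intro x
        refine HasDerivAt.add_const _ ?_
        apply HasDerivAt.fun_sum
        intro i _
        exact ((((hasDerivAt_id x).neg).mul_const (d i)).exp).const_mul (Λ i)
      obtain ⟨Z', hZ1, hZ2⟩ := BH_rolle _ _ hg S hP0
      have hdisj : Disjoint Z' (S.erase τ) := by
        rw [Finset.disjoint_left]
        intro z hz hz'
        exact (hZ2 z hz).2.1 (Finset.mem_of_mem_erase hz')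
      have hcount := BH_expPoly_zeros (Finset.univ.image d)
        (Function.extend d (fun i => Λ i * d i) 0) (by
          obtain ⟨i, hi⟩ := Function.ne_iff.1 hz
          refine ⟨d i, Finset.mem_image_of_mem _ (Finset.mem_univ _), ?_⟩
          rw [hinj.extend_apply]
          exact mul_ne_zero hi (hd i).ne') (Z' ∪ S.erase τ) (by
          intro z hz
          rw [Finset.sum_image (fun i _ j _ h => hinj h)]
          simp only [hinj.extend_apply]
          rcases Finset.mem_union.1 hz with h | h
          · have := (hZ2 z h).1
            rw [← neg_eq_zero, ← this, ← Finset.sum_neg_distrib]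
            refine Finset.sum_congr rfl fun i _ => ?_
            ring_nf
          · rw [← hP1 z h]
            refine Finset.sum_congr rfl fun i _ => ?_
            ring_nf)
      rw [Finset.card_union_of_disjoint hdisj, Finset.card_image_of_injective _ hinj] at hcount
      have := Finset.pred_card_le_card_erase (s := S) (a := τ)
      simp at hcount
      omega
  · intro s hs
    obtain ⟨k, hkK, rfl⟩ := Finset.mem_image.1 hs
    refine ⟨by simp only [hα]; nlinarith [sq_nonneg (a k)], ?_⟩
    apply Finset.sum_pos
    · intro j hj
      have := (Finset.mem_filter.1 (Finset.mem_filter.1 hj).1).2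
      positivity
    · exact ⟨k, by simp [hkK]⟩
  · have := hsum 0
    simp only [mul_zero, Real.exp_zero, mul_one] at this
    rw [this]
    exact hle


/-- Division of a bounded entire function by a Blaschke factor of the right half plane. -/
theorem BH_divide (f : ℂ → ℂ) (hf : Differentiable ℂ f) (C : ℝ)
    (hC : ∀ z : ℂ, 0 ≤ z.re → ‖f z‖ ≤ C) (a : ℝ) (ha : 0 < a) (hfa : f a = 0) :
    ∃ k : ℂ → ℂ, Differentiable ℂ k ∧ (∀ z : ℂ, 0 ≤ z.re → ‖k z‖ ≤ C) ∧
      ∀ z, f z * (z + a) = k z * (z - a) := by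
  have hds : Differentiable ℂ (dslope f a) := by
    rw [← differentiableOn_univ]
    exact (Complex.differentiableOn_dslope Filter.univ_mem).2 hf.differentiableOn
  have hmul : ∀ z, f z * (z + a) = (dslope f a z * (z + a)) * (z - a) := by
    intro z
    have := sub_smul_dslope f (a : ℂ) z
    rw [hfa, sub_zero, smul_eq_mul] at this
    rw [← this]; ring
  refine ⟨fun z => dslope f a z * (z + a), by fun_prop, ?_, hmul⟩
  set k : ℂ → ℂ := fun z => dslope f a z * (z + a) with hk
  have hkd : Differentiable ℂ k := by fun_prop
  have hbound : ∀ z : ℂ, 0 ≤ z.re → 3 * a ≤ ‖z‖ → ‖k z‖ ≤ 2 * C := by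
    intro z hz hza
    have h1 : ‖z‖ - a ≤ ‖z - a‖ := by
      have := norm_sub_norm_le z (a:ℂ)
      rwa [Complex.norm_of_nonneg ha.le] at this
    have h2 : ‖z + a‖ ≤ ‖z‖ + a := by
      have := norm_add_le z (a:ℂ)
      rwa [Complex.norm_of_nonneg ha.le] at this
    have h3 : ‖f z‖ * ‖z + a‖ = ‖k z‖ * ‖z - a‖ := by
      rw [← norm_mul, ← norm_mul, hmul]
    have h4 := hC z hz
    have h5 : 0 ≤ C := (norm_nonneg _).trans h4
    have h6 : ‖z + a‖ ≤ 2 * ‖z - a‖ := by linarith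
    have h7 : 0 < ‖z - a‖ := by linarith
    have h8 : ‖k z‖ * ‖z - a‖ ≤ 2 * C * ‖z - a‖ := by
      rw [← h3]
      calc ‖f z‖ * ‖z + a‖ ≤ C * (2 * ‖z - a‖) := mul_le_mul h4 h6 (norm_nonneg _) h5
        _ = _ := by ring
    exact le_of_mul_le_mul_right h8 h7
  intro z hz
  refine PhragmenLindelof.right_half_plane_of_bounded_on_real (f := k) hkd.diffContOnCl
    ⟨1, by norm_num, 0, ?_⟩ ?_ ?_ hz
  · simp only [zero_mul, Real.exp_zero]
    refine Asymptotics.IsBigO.of_bound (2 * C) ?_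
    have h1 : ∀ᶠ z : ℂ in Bornology.cobounded ℂ, 3 * a ≤ ‖z‖ :=
      tendsto_norm_cobounded_atTop.eventually_ge_atTop (3 * a)
    have h2 := h1.filter_mono (inf_le_left (b := Filter.principal {z : ℂ | 0 < z.re}))
    have h3 : ∀ᶠ z : ℂ in Bornology.cobounded ℂ ⊓ Filter.principal {z : ℂ | 0 < z.re}, 0 < z.re :=
      (Filter.eventually_principal.2 (fun z hz => hz)).filter_mono inf_le_right
    filter_upwards [h2, h3] with z hz1 hz2
    simpa using hbound z hz2.le hz1
  · refine ⟨2 * C, ?_⟩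
    rw [Filter.eventually_map]
    filter_upwards [Filter.eventually_ge_atTop (3 * a)] with x hx
    apply hbound
    · simp; linarith
    · rw [Complex.norm_of_nonneg (by linarith)]; exact hx
  · intro x
    have h3 : ‖f (x * Complex.I)‖ * ‖x * Complex.I + a‖ = ‖k (x * Complex.I)‖ * ‖x * Complex.I - a‖ := by
      rw [← norm_mul, ← norm_mul, hmul]
    have h4 : ‖x * Complex.I + a‖ = ‖x * Complex.I - a‖ := by
      rw [Complex.norm_def, Complex.norm_def]
      congr 1
      simp [Complex.normSq_apply]
    have h5 : 0 < ‖x * Complex.I - a‖ := by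
      rw [norm_pos_iff]
      intro h
      have := congrArg Complex.re h
      simp at this
      exact ha.ne' this
    rw [h4] at h3
    rw [← mul_right_cancel₀ h5.ne' h3]
    exact hC _ (by simp)

theorem BH_blaschke : ∀ (n : ℕ) (a : Fin n → ℝ), Function.Injective a → (∀ i, 0 < a i) →
    ∀ (f : ℂ → ℂ), Differentiable ℂ f → ∀ C : ℝ, (∀ z : ℂ, 0 ≤ z.re → ‖f z‖ ≤ C) →
    (∀ i, f (a i) = 0) → ∀ x : ℝ, 0 ≤ x → ‖f x‖ ≤ C * ∏ i, (|x - a i| / (x + a i)) := by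
  intro n
  induction n with
  | zero => intro a _ _ f _ C hC _ x hx; simpa using hC x (by simpa using hx)
  | succ n ih =>
    intro a hinj hpos f hf C hC hz x hx
    obtain ⟨k, hkd, hkC, hk⟩ := BH_divide f hf C hC (a 0) (hpos 0) (hz 0)
    have := ih (fun i => a i.succ) (hinj.comp (Fin.succ_injective _)) (fun i => hpos _) k hkd C hkC
      (by
        intro i
        have h := hk (a i.succ)
        rw [hz, zero_mul] at h
        refine (mul_eq_zero.1 h.symm).resolve_right ?_
        refine sub_ne_zero.2 ?_
        intro h'
        have := hinj (Complex.ofReal_injective h')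
        exact Fin.succ_ne_zero _ this) x hx
    have h0 := hpos 0
    have hxa : 0 < x + a 0 := by linarith
    have h1 : ‖f x‖ * (x + a 0) = ‖k x‖ * |x - a 0| := by
      have h := congrArg norm (hk x)
      rw [norm_mul, norm_mul, ← Complex.ofReal_add, ← Complex.ofReal_sub,
        Complex.norm_of_nonneg hxa.le, Complex.norm_real, Real.norm_eq_abs] at h
      exact h
    rw [Fin.prod_univ_succ]
    have h2 : ‖f x‖ = ‖k x‖ * (|x - a 0| / (x + a 0)) := by
      field_simp
      exact h1
    rw [h2]
    calc _ ≤ (C * ∏ i : Fin n, (|x - a i.succ| / (x + a i.succ))) * (|x - a 0| / (x + a 0)) := by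
            gcongr
      _ = _ := by ring


noncomputable def BHg (r : ℝ) : ℝ := Real.log (1 + Real.exp (-r)) - Real.log (1 - Real.exp (-r))

noncomputable def BHG (r : ℝ) : ℝ := ∑' n : ℕ, 2 / (2 * (n : ℝ) + 1) ^ 2 * Real.exp (-(2 * n + 1) * r)

theorem BHg_hasSum (r : ℝ) (hr : 0 < r) :
    HasSum (fun n : ℕ => 2 / (2 * (n : ℝ) + 1) * Real.exp (-(2 * n + 1) * r)) (BHg r) := by
  have h1 : |Real.exp (-r)| < 1 := by
    rw [abs_of_pos (Real.exp_pos _)]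
    exact Real.exp_zero ▸ Real.exp_lt_exp.2 (by linarith)
  have := Real.hasSum_log_sub_log_of_abs_lt_one h1
  have e : (fun n : ℕ => 2 / (2 * (n : ℝ) + 1) * Real.exp (-(2 * n + 1) * r)) =
      (fun n : ℕ => 2 * (1 / (2 * (n : ℝ) + 1)) * Real.exp (-r) ^ (2 * n + 1)) := by
    funext n
    rw [← Real.exp_nat_mul]
    push_cast
    ring_nf
  rw [e]
  exact this

theorem BH_odd_sum : HasSum (fun n : ℕ => 2 / (2 * (n : ℝ) + 1) ^ 2) (Real.pi ^ 2 / 4) := by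
  obtain ⟨F, hF⟩ : ∃ F : ℕ → ℝ, F = fun n : ℕ => (1 : ℝ) / (n : ℝ) ^ 2 := ⟨_, rfl⟩
  have h : HasSum F (Real.pi ^ 2 / 6) := by rw [hF]; exact hasSum_zeta_two
  have he : HasSum (fun n : ℕ => F (2 * n)) (Real.pi ^ 2 / 24) := by
    have e : (fun n : ℕ => F (2 * n)) = (fun n : ℕ => (1 / 4 : ℝ) * F n) := by
      funext n
      rw [hF]
      push_cast
      rw [mul_pow, one_div_mul_one_div]
      norm_num
    rw [e, show Real.pi ^ 2 / 24 = 1 / 4 * (Real.pi ^ 2 / 6) by ring]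
    exact h.mul_left (1 / 4)
  have hs : Summable (fun n : ℕ => F (2 * n + 1)) :=
    h.summable.comp_injective (i := fun n : ℕ => 2 * n + 1) (fun a b hab => by
      have : 2 * a + 1 = 2 * b + 1 := hab
      omega)
  have h2 := (he.even_add_odd hs.hasSum).unique h
  have h3 : ∑' n : ℕ, F (2 * n + 1) = Real.pi ^ 2 / 8 := by linarith
  have h4 := hs.hasSum.mul_left 2
  rw [h3] at h4
  have e : (fun n : ℕ => 2 / (2 * (n : ℝ) + 1) ^ 2) = (fun n : ℕ => 2 * F (2 * n + 1)) := by
    funext n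
    rw [hF]
    push_cast
    ring
  rw [e, show Real.pi ^ 2 / 4 = 2 * (Real.pi ^ 2 / 8) by ring]
  exact h4

theorem BHG_summable (r : ℝ) (hr : 0 ≤ r) :
    Summable (fun n : ℕ => 2 / (2 * (n : ℝ) + 1) ^ 2 * Real.exp (-(2 * n + 1) * r)) := by
  refine BH_odd_sum.summable.of_nonneg_of_le (fun n => by positivity) (fun n => ?_)
  have : Real.exp (-(2 * n + 1) * r) ≤ 1 := Real.exp_le_one_iff.2 (by
    have : 0 ≤ (2 * (n:ℝ) + 1) * r := by positivity
    linarith)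
  have h2 : (0:ℝ) ≤ 2 / (2 * (n : ℝ) + 1) ^ 2 := by positivity
  nlinarith

theorem BHG_hasSum (r : ℝ) (hr : 0 ≤ r) :
    HasSum (fun n : ℕ => 2 / (2 * (n : ℝ) + 1) ^ 2 * Real.exp (-(2 * n + 1) * r)) (BHG r) :=
  (BHG_summable r hr).hasSum

theorem BH_scalar (x : ℝ) (hx : 0 ≤ x) : 2 * (1 - Real.exp (-x)) ≤ x * (1 + Real.exp (-x)) := by
  have hd : ∀ y : ℝ, HasDerivAt (fun x => x * (1 + Real.exp (-x)) - 2 * (1 - Real.exp (-x)))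
      (1 - Real.exp (-y) - y * Real.exp (-y)) y := by
    intro y
    have he : HasDerivAt (fun x : ℝ => Real.exp (-x)) (Real.exp (-y) * (-1)) y :=
      (hasDerivAt_neg y).exp
    have := ((hasDerivAt_id y).mul (he.const_add 1)).sub ((he.const_sub 1).const_mul 2)
    refine this.congr_deriv ?_
    simp
    ring
  have hm : MonotoneOn (fun x => x * (1 + Real.exp (-x)) - 2 * (1 - Real.exp (-x))) (Set.Ici 0) := by
    refine monotoneOn_of_deriv_nonneg (convex_Ici 0)
      (fun y _ => (hd y).continuousAt.continuousWithinAt)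
      (fun y _ => (hd y).differentiableAt.differentiableWithinAt) (fun y _ => ?_)
    rw [(hd y).deriv]
    have h1 := Real.add_one_le_exp y
    have h2 : Real.exp y * Real.exp (-y) = 1 := by rw [← Real.exp_add]; simp
    nlinarith [Real.exp_pos (-y)]
  have := hm (Set.mem_Ici.2 le_rfl) (Set.mem_Ici.2 hx) hx
  simp at this
  linarith

theorem BH_trap (d h : ℝ) (hd : 0 < d) (hh : 0 < h) :
    (BHG d - BHG (d + h)) / h ≤ (BHg d + BHg (d + h)) / 2 := by
  have h1 := ((BHG_hasSum d hd.le).sub (BHG_hasSum (d + h) (by linarith))).div_const h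
  have h2 := ((BHg_hasSum d hd).add (BHg_hasSum (d + h) (by linarith))).div_const 2
  refine hasSum_le (fun n => ?_) h1 h2
  set q : ℝ := 2 * (n : ℝ) + 1 with hq
  have hq0 : 0 < q := by positivity
  have hs := BH_scalar (q * h) (by positivity)
  have he : Real.exp (-q * (d + h)) = Real.exp (-q * d) * Real.exp (-(q * h)) := by
    rw [← Real.exp_add]; ring_nf
  rw [he]
  have hE := Real.exp_pos (-q * d)
  have : (2 / q * Real.exp (-q * d) + 2 / q * (Real.exp (-q * d) * Real.exp (-(q * h)))) / 2 -
      (2 / q ^ 2 * Real.exp (-q * d) - 2 / q ^ 2 * (Real.exp (-q * d) * Real.exp (-(q * h)))) / h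
      = Real.exp (-q * d) / (q ^ 2 * h) *
        (q * h * (1 + Real.exp (-(q * h))) - 2 * (1 - Real.exp (-(q * h)))) := by
    field_simp
  have h3 : 0 ≤ Real.exp (-q * d) / (q ^ 2 * h) *
        (q * h * (1 + Real.exp (-(q * h))) - 2 * (1 - Real.exp (-(q * h)))) :=
    mul_nonneg (by positivity) (by linarith)
  linarith

theorem BH_sum_lower (d h : ℝ) (hd : 0 < d) (hh : 0 < h) (J : ℕ) :
    (BHG d - BHG (d + J * h)) / h + (BHg d - BHg (d + J * h)) / 2
      ≤ ∑ m ∈ range J, BHg (d + m * h) := by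
  induction J with
  | zero => simp
  | succ J ih =>
    rw [Finset.sum_range_succ]
    have := BH_trap (d + J * h) h (by positivity) hh
    have e : d + J * h + h = d + (J + 1 : ℕ) * h := by push_cast; ring
    rw [e] at this
    rw [sub_div] at *
    linarith

theorem BH_tail (s h : ℝ) (hs : 0 < s) (hh : 0 < h) :
    BHG (s + h / 2) / h + BHg (s + h / 2) / 2 ≤ BHG s / h := by
  have h1 := ((BHG_hasSum (s + h / 2) (by linarith)).div_const h).add
    ((BHg_hasSum (s + h / 2) (by linarith)).div_const 2)
  have h2 := (BHG_hasSum s hs.le).div_const h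
  refine hasSum_le (fun n => ?_) h1 h2
  set q : ℝ := 2 * (n : ℝ) + 1 with hq
  have hq0 : 0 < q := by positivity
  have he : Real.exp (-q * s) = Real.exp (-q * (s + h / 2)) * Real.exp (q * h / 2) := by
    rw [← Real.exp_add]; ring_nf
  rw [he]
  have hx := Real.add_one_le_exp (q * h / 2)
  have hE := Real.exp_pos (-q * (s + h / 2))
  have : 2 / q ^ 2 * (Real.exp (-q * (s + h / 2)) * Real.exp (q * h / 2)) / h -
      (2 / q ^ 2 * Real.exp (-q * (s + h / 2)) / h + 2 / q * Real.exp (-q * (s + h / 2)) / 2)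
      = 2 * Real.exp (-q * (s + h / 2)) / (q ^ 2 * h) *
        (Real.exp (q * h / 2) - (q * h / 2 + 1)) := by
    field_simp
    ring
  have h3 : 0 ≤ 2 * Real.exp (-q * (s + h / 2)) / (q ^ 2 * h) *
        (Real.exp (q * h / 2) - (q * h / 2 + 1)) :=
    mul_nonneg (by positivity) (by linarith)
  linarith

theorem BHG_le (s : ℝ) (hs : 0 ≤ s) : BHG s ≤ Real.pi ^ 2 / 4 * Real.exp (-s) := by
  refine hasSum_le (fun n => ?_) (BHG_hasSum s hs) (BH_odd_sum.mul_right (Real.exp (-s)))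
  gcongr
  nlinarith [(Nat.cast_nonneg n : (0:ℝ) ≤ n), mul_nonneg (Nat.cast_nonneg n : (0:ℝ) ≤ n) hs]

theorem BHg_anti (a b : ℝ) (ha : 0 < a) (hab : a ≤ b) : BHg b ≤ BHg a := by
  refine hasSum_le (fun n => ?_) (BHg_hasSum b (by linarith)) (BHg_hasSum a ha)
  have : 0 ≤ 2 * (n : ℝ) + 1 := by positivity
  refine mul_le_mul_of_nonneg_left (Real.exp_le_exp.2 ?_) (by positivity)
  nlinarith

theorem BHG_hasDeriv (r : ℝ) (hr : 0 < r) : HasDerivAt BHG (-BHg r) r := by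
  have hu : Summable (fun n : ℕ => 2 / (2 * (n : ℝ) + 1) * Real.exp (-(2 * n + 1) * (r / 2))) :=
    (BHg_hasSum (r / 2) (by linarith)).summable
  have hmem : r ∈ Set.Ioi (r / 2) := by simp; linarith
  have := hasDerivAt_tsum_of_isPreconnected (t := Set.Ioi (r / 2)) (y₀ := r) (y := r)
    (g := fun (n : ℕ) (y : ℝ) => 2 / (2 * (n : ℝ) + 1) ^ 2 * Real.exp (-(2 * n + 1) * y))
    (g' := fun (n : ℕ) (y : ℝ) => 2 / (2 * (n : ℝ) + 1) ^ 2 *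
      (Real.exp (-(2 * n + 1) * y) * (-(2 * n + 1) * 1))) hu isOpen_Ioi
    (convex_Ioi _).isPreconnected
    (fun n y _ => (((hasDerivAt_id y).const_mul (-(2 * (n:ℝ) + 1))).exp).const_mul _)
    (fun n y hy => ?_) hmem (BHG_summable r hr.le) hmem
  · refine this.congr_deriv ?_
    rw [← (BHg_hasSum r hr).tsum_eq, ← tsum_neg]
    congr 1
    ext n
    field_simp
  · have hy' : r / 2 < y := hy
    have e : 2 / (2 * (n : ℝ) + 1) ^ 2 * (Real.exp (-(2 * n + 1) * y) * (-(2 * n + 1) * 1))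
      = - (2 / (2 * (n : ℝ) + 1) * Real.exp (-(2 * n + 1) * y)) := by field_simp
    rw [e, norm_neg, Real.norm_of_nonneg (by positivity)]
    have : 0 ≤ 2 * (n : ℝ) + 1 := by positivity
    refine mul_le_mul_of_nonneg_left (Real.exp_le_exp.2 ?_) (by positivity)
    nlinarith

theorem BHg_hasDeriv (r : ℝ) (hr : 0 < r) : HasDerivAt BHg (-(1 / Real.sinh r)) r := by
  have he : HasDerivAt (fun x : ℝ => Real.exp (-x)) (Real.exp (-r) * (-1)) r :=
    (hasDerivAt_neg r).exp
  have hlt : Real.exp (-r) < 1 := Real.exp_zero ▸ Real.exp_lt_exp.2 (by linarith)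
  have hp := Real.exp_pos (-r)
  have h := ((he.const_add 1).log (by positivity)).sub ((he.const_sub 1).log (by linarith))
  refine h.congr_deriv ?_
  have hs : Real.sinh r = (1 / Real.exp (-r) - Real.exp (-r)) / 2 := by
    rw [Real.sinh_eq, Real.exp_neg r]; simp
  rw [hs]
  have h1 : (1:ℝ) - Real.exp (-r) ≠ 0 := by linarith
  have h2 : 1 / Real.exp (-r) - Real.exp (-r) ≠ 0 := by
    have : 1 < 1 / Real.exp (-r) := by rw [lt_div_iff₀ hp]; linarith
    linarith
  have h3 : 1 - Real.exp (-r) ^ 2 ≠ 0 := by nlinarith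
  field_simp
  ring

theorem BHG_lower (d : ℝ) (hd : 0 < d) : Real.pi ^ 2 / 4 ≤ BHG d + d * BHg d + d := by
  have hder : ∀ y : ℝ, 0 < y → HasDerivAt (fun r => BHG r + r * BHg r + r)
      (1 - y / Real.sinh y) y := by
    intro y hy
    have := ((BHG_hasDeriv y hy).add ((hasDerivAt_id y).mul (BHg_hasDeriv y hy))).add (hasDerivAt_id y)
    refine this.congr_deriv ?_
    simp
    ring
  have hm : MonotoneOn (fun r => BHG r + r * BHg r + r) (Set.Ioi 0) := by
    refine monotoneOn_of_deriv_nonneg (convex_Ioi 0)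
      (fun y hy => (hder y hy).continuousAt.continuousWithinAt)
      (fun y hy => (hder y (interior_subset hy)).differentiableAt.differentiableWithinAt)
      (fun y hy => ?_)
    have hy : 0 < y := interior_subset hy
    rw [(hder y hy).deriv]
    have h1 : y ≤ Real.sinh y := Real.self_le_sinh_iff.2 hy.le
    have : y / Real.sinh y ≤ 1 := div_le_one_of_le₀ h1 (by linarith)
    linarith
  have hcont : Continuous (fun r : ℝ => ∑' n : ℕ, 2 / (2 * (n : ℝ) + 1) ^ 2 *
      Real.exp (-(2 * n + 1) * |r|)) := by
    refine continuous_tsum (fun n => by fun_prop) BH_odd_sum.summable (fun n x => ?_)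
    rw [Real.norm_of_nonneg (by positivity)]
    have : Real.exp (-(2 * n + 1) * |x|) ≤ 1 := Real.exp_le_one_iff.2 (by
      have : 0 ≤ (2 * (n:ℝ) + 1) * |x| := by positivity
      linarith)
    have h2 : (0:ℝ) ≤ 2 / (2 * (n : ℝ) + 1) ^ 2 := by positivity
    nlinarith
  have ht := (hcont.tendsto 0).mono_left (nhdsWithin_le_nhds (s := Set.Ioi 0))
  have h0 : ∑' n : ℕ, 2 / (2 * (n : ℝ) + 1) ^ 2 * Real.exp (-(2 * n + 1) * |(0:ℝ)|)
      = Real.pi ^ 2 / 4 := by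
    rw [← BH_odd_sum.tsum_eq]
    simp
  rw [h0] at ht
  refine le_of_tendsto ht ?_
  have : Set.Ioo 0 d ∈ nhdsWithin (0:ℝ) (Set.Ioi 0) := Ioo_mem_nhdsGT hd
  filter_upwards [this] with r hr
  have h1 := hm (Set.mem_Ioi.2 hr.1) (Set.mem_Ioi.2 hd) hr.2.le
  simp only at h1
  rw [abs_of_pos hr.1]
  have h2 : 0 ≤ BHg r := (BHg_hasSum r hr.1).nonneg (fun n => by positivity)
  have h3 : 0 ≤ r * BHg r := mul_nonneg hr.1.le h2
  have h4 := hr.1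
  change BHG r ≤ _
  linarith

theorem BH_center (d₁ d₂ h : ℝ) (h1 : 0 < d₁) (h2 : 0 < d₂) (hh : d₁ + d₂ = h) :
    Real.pi ^ 2 / (2 * h) - 1 ≤ (BHG d₁ + BHG d₂) / h + (BHg d₁ + BHg d₂) / 2 := by
  have hpos : 0 < h := by linarith
  have a1 := BHG_lower d₁ h1
  have a2 := BHG_lower d₂ h2
  have a3 : 0 ≤ (d₂ - d₁) * (BHg d₁ - BHg d₂) := by
    rcases le_total d₁ d₂ with h | h
    · exact mul_nonneg (by linarith) (by linarith [BHg_anti d₁ d₂ h1 h])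
    · exact mul_nonneg_of_nonpos_of_nonpos (by linarith) (by linarith [BHg_anti d₂ d₁ h2 h])
  have e : (BHG d₁ + BHG d₂) / h + (BHg d₁ + BHg d₂) / 2 - (Real.pi ^ 2 / (2 * h) - 1)
    = (BHG d₁ + BHG d₂ + h * (BHg d₁ + BHg d₂) / 2 - Real.pi ^ 2 / 2 + h) / h := by
    field_simp
    ring
  have : 0 ≤ (BHG d₁ + BHG d₂ + h * (BHg d₁ + BHg d₂) / 2 - Real.pi ^ 2 / 2 + h) / h := by
    apply div_nonneg _ hpos.le
    subst hh
    nlinarith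
  linarith

theorem BH_grid (n i : ℕ) (hi : i ≤ n) (h u : ℝ) (hh : 0 < h) (hn : 0 < n) (hu0 : 0 ≤ u)
    (hun : u ≤ n * h)
    (h1 : 0 < u - (i - 1 / 2) * h) (h2 : 0 < (i + 1 / 2) * h - u) :
    Real.pi ^ 2 / (2 * h) * (1 - (Real.exp (-(n * h)) + Real.exp (-(2 * (n * h)))) / 2) - 1 ≤
      ∑ m ∈ range (n + i), BHg (u - (i - 1 / 2) * h + m * h) +
      ∑ m ∈ range (2 * n - i), BHg ((i + 1 / 2) * h - u + m * h) := by
  have hnh : 0 < n * h := by positivity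
  have a1 := BH_sum_lower _ h h1 hh (n + i)
  have a2 := BH_sum_lower _ h h2 hh (2 * n - i)
  have a3 := BH_center _ _ h h1 h2 (by ring)
  have e1 : u - (i - 1 / 2) * h + (n + i : ℕ) * h = (u + n * h) + h / 2 := by push_cast; ring
  have e2 : (i + 1 / 2) * h - u + (2 * n - i : ℕ) * h = (2 * (n * h) - u) + h / 2 := by
    rw [Nat.cast_sub (by omega)]; push_cast; ring
  rw [e1] at a1
  rw [e2] at a2
  have a4 := BH_tail (u + n * h) h (by linarith) hh
  have a5 := BH_tail (2 * (n * h) - u) h (by linarith) hh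
  have a6 := BHG_le (u + n * h) (by linarith)
  have a7 := BHG_le (2 * (n * h) - u) (by linarith)
  have a8 : Real.exp (-(u + n * h)) + Real.exp (-(2 * (n * h) - u)) ≤
      Real.exp (-(n * h)) + Real.exp (-(2 * (n * h))) := by
    set A := Real.exp (-u) with hA
    set q := Real.exp (-(n * h)) with hq
    have b1 : Real.exp (-(u + n * h)) = A * q := by rw [hA, hq, ← Real.exp_add]; ring_nf
    have b2 : Real.exp (-(2 * (n * h) - u)) = q * q / A := by
      rw [hA, hq, ← Real.exp_add, ← Real.exp_sub]; ring_nf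
    have b3 : Real.exp (-(2 * (n * h))) = q * q := by rw [hq, ← Real.exp_add]; ring_nf
    rw [b1, b2, b3]
    have hA0 : 0 < A := Real.exp_pos _
    have hq0 : 0 < q := Real.exp_pos _
    have c1 : A ≤ 1 := Real.exp_le_one_iff.2 (by linarith)
    have c2 : q ≤ A := Real.exp_le_exp.2 (by linarith)
    have c3 : q + q * q - (A * q + q * q / A) = q * ((1 - A) * (A - q)) / A := by
      field_simp; ring
    have c4 : 0 ≤ q * ((1 - A) * (A - q)) / A := by
      apply div_nonneg _ hA0.le
      exact mul_nonneg hq0.le (mul_nonneg (by linarith) (by linarith))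
    linarith
  have a9 : (BHG (u + n * h) + BHG (2 * (n * h) - u)) / h ≤
      Real.pi ^ 2 / (2 * h) * ((Real.exp (-(n * h)) + Real.exp (-(2 * (n * h)))) / 2) := by
    rw [div_le_iff₀ hh]
    have : Real.pi ^ 2 / (2 * h) * ((Real.exp (-(n * h)) + Real.exp (-(2 * (n * h)))) / 2) * h
      = Real.pi ^ 2 / 4 * (Real.exp (-(n * h)) + Real.exp (-(2 * (n * h)))) := by
      field_simp
      ring
    rw [this]
    have : 0 ≤ Real.pi ^ 2 / 4 := by positivity
    nlinarith
  simp only [sub_div, add_div, mul_sub, mul_one] at *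
  linarith


theorem BH_grid_sum (n i : ℕ) (hi : i ≤ n) (h u : ℝ) (hh : 0 < h)
    (h1 : 0 < u - (i - 1 / 2) * h) (h2 : 0 < (i + 1 / 2) * h - u) :
      ∑ m ∈ range (n + i), BHg (u - (i - 1 / 2) * h + m * h) +
      ∑ m ∈ range (2 * n - i), BHg ((i + 1 / 2) * h - u + m * h) =
      ∑ j ∈ range n, (BHg |u - (j + 1 / 2) * h| + BHg (u + (j + 1 / 2) * h) +
        BHg (2 * (n * h) - u - (j + 1 / 2) * h)) := by
  obtain ⟨r, rfl⟩ := Nat.exists_eq_add_of_le hi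
  have c1 : i + r + i = i + (i + r) := by omega
  have c2 : 2 * (i + r) - i = r + (i + r) := by omega
  rw [c1, c2, Finset.sum_range_add _ i (i + r), Finset.sum_range_add _ r (i + r)]
  rw [Finset.sum_add_distrib, Finset.sum_add_distrib]
  have e1 : ∑ j ∈ range (i + r), BHg |u - (j + 1 / 2) * h| =
      ∑ m ∈ range i, BHg (u - (i - 1 / 2) * h + m * h) +
      ∑ m ∈ range r, BHg ((i + 1 / 2) * h - u + m * h) := by
    rw [Finset.sum_range_add _ i r, ← Finset.sum_range_reflect _ i]
    congr 1
    · refine Finset.sum_congr rfl fun m hm => ?_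
      have hm := Finset.mem_range.1 hm
      have : ((i - 1 - m : ℕ) : ℝ) = i - 1 - m := by
        rw [Nat.cast_sub (by omega), Nat.cast_sub (by omega)]; simp
      rw [this]
      have e : u - ((i:ℝ) - 1 - m + 1 / 2) * h = u - (i - 1 / 2) * h + m * h := by ring
      rw [e, abs_of_pos (by positivity)]
    · refine Finset.sum_congr rfl fun m hm => ?_
      have e : u - (((i + m : ℕ) : ℝ) + 1 / 2) * h = -((i + 1 / 2) * h - u + m * h) := by
        push_cast; ring
      rw [e, abs_neg, abs_of_pos (by positivity)]
  have e2 : ∑ j ∈ range (i + r), BHg (u + (j + 1 / 2) * h) =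
      ∑ m ∈ range (i + r), BHg (u - (i - 1 / 2) * h + (i + m : ℕ) * h) := by
    refine Finset.sum_congr rfl fun m hm => ?_
    congr 1
    push_cast; ring
  have e3 : ∑ j ∈ range (i + r), BHg (2 * ((i + r : ℕ) * h) - u - (j + 1 / 2) * h) =
      ∑ m ∈ range (i + r), BHg ((i + 1 / 2) * h - u + (r + m : ℕ) * h) := by
    rw [← Finset.sum_range_reflect _ (i + r)]
    refine Finset.sum_congr rfl fun m hm => ?_
    have hm := Finset.mem_range.1 hm
    have : ((i + r - 1 - m : ℕ) : ℝ) = (i + r : ℕ) - 1 - m := by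
      rw [Nat.cast_sub (by omega), Nat.cast_sub (by omega)]; simp
    rw [this]
    congr 1
    push_cast; ring
  rw [e1, e2, e3]
  ring

theorem BH_grid_lower (n : ℕ) (hn : 0 < n) (h u : ℝ) (hh : 0 < h) (hu0 : 0 ≤ u)
    (hun : u ≤ n * h) (hne : ∀ j < n, u ≠ (j + 1 / 2) * h) :
    Real.pi ^ 2 / (2 * h) * (1 - (Real.exp (-(n * h)) + Real.exp (-(2 * (n * h)))) / 2) - 1 ≤
      ∑ j ∈ range n, (BHg |u - (j + 1 / 2) * h| + BHg (u + (j + 1 / 2) * h) +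
        BHg (2 * (n * h) - u - (j + 1 / 2) * h)) := by
  set i := ⌊u / h + 1 / 2⌋₊ with hi
  have f1 : (i : ℝ) ≤ u / h + 1 / 2 := Nat.floor_le (by positivity)
  have f2 : u / h + 1 / 2 < i + 1 := Nat.lt_floor_add_one _
  have f3 : u / h * h = u := by field_simp
  have f4 : u / h ≤ n := by rw [div_le_iff₀ hh]; exact hun
  have hin : i ≤ n := by
    have : (i : ℝ) < n + 1 := by linarith
    exact_mod_cast Nat.lt_succ_iff.1 (by exact_mod_cast this)
  have h2 : 0 < (i + 1 / 2) * h - u := by nlinarith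
  have h1' : 0 ≤ u - (i - 1 / 2) * h := by nlinarith
  have h1 : 0 < u - (i - 1 / 2) * h := by
    rcases h1'.lt_or_eq with h | h
    · exact h
    · exfalso
      rcases Nat.eq_zero_or_pos i with h0 | h0
      · rw [h0] at h; push_cast at h; nlinarith
      · refine hne (i - 1) (by omega) ?_
        rw [Nat.cast_sub h0]; push_cast; linarith
  rw [← BH_grid_sum n i hin h u hh h1 h2]
  exact BH_grid n i hin h u hh hn hu0 hun h1 h2

theorem BHg_exp (r : ℝ) (hr : 0 < r) :
    Real.exp (-BHg r) = (1 - Real.exp (-r)) / (1 + Real.exp (-r)) := by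
  have hlt : Real.exp (-r) < 1 := Real.exp_zero ▸ Real.exp_lt_exp.2 (by linarith)
  have hp := Real.exp_pos (-r)
  rw [BHg, neg_sub, Real.exp_sub, Real.exp_log (by linarith), Real.exp_log (by linarith)]

theorem BH_cosh_ratio (u v : ℝ) (hv : 0 ≤ v) (huv : v < u) :
    |Real.cosh u - Real.cosh v| / (Real.cosh u + Real.cosh v) =
      Real.exp (-BHg |u - v|) * Real.exp (-BHg (u + v)) := by
  have hc : Real.cosh v ≤ Real.cosh u := by
    rw [Real.cosh_le_cosh, abs_of_nonneg hv, abs_of_nonneg (by linarith)]; exact huv.le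
  rw [abs_of_nonneg (by linarith), abs_of_pos (by linarith : 0 < u - v),
    BHg_exp _ (by linarith), BHg_exp _ (by linarith), Real.cosh_eq, Real.cosh_eq]
  have e1 : Real.exp (-(u - v)) = Real.exp v / Real.exp u := by rw [← Real.exp_sub]; ring_nf
  have e2 : Real.exp (-(u + v)) = 1 / (Real.exp v * Real.exp u) := by
    rw [← Real.exp_add, one_div, ← Real.exp_neg]; ring_nf
  rw [e1, e2, Real.exp_neg, Real.exp_neg]
  have p1 := Real.exp_pos u
  have p2 := Real.exp_pos v
  field_simp
  ring

theorem BH_cosh_ratio' (u v : ℝ) (hu : 0 ≤ u) (hv : 0 ≤ v) (huv : u ≠ v) :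
    |Real.cosh u - Real.cosh v| / (Real.cosh u + Real.cosh v) =
      Real.exp (-BHg |u - v|) * Real.exp (-BHg (u + v)) := by
  rcases lt_or_gt_of_ne huv with h | h
  · have := BH_cosh_ratio v u hu h
    rw [abs_sub_comm u v, abs_sub_comm (Real.cosh u), add_comm u v, add_comm (Real.cosh u)]
    exact this
  · exact BH_cosh_ratio u v hv h

noncomputable def BHx (l u : ℝ) : ℝ := Real.cosh u + Real.cosh l ^ 2 / Real.cosh u

theorem BHx_pos (l u : ℝ) : 0 < BHx l u := by
  unfold BHx
  have := Real.cosh_pos u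
  have := Real.cosh_pos l
  positivity

theorem BHx_ratio (l u v : ℝ) :
    |BHx l u - BHx l v| / (BHx l u + BHx l v) =
      |Real.cosh u - Real.cosh v| / (Real.cosh u + Real.cosh v) *
      (|Real.cosh l ^ 2 - Real.cosh u * Real.cosh v| / (Real.cosh l ^ 2 + Real.cosh u * Real.cosh v)) := by
  unfold BHx
  have p1 := Real.cosh_pos u
  have p2 := Real.cosh_pos v
  have p3 := Real.cosh_pos l
  set a := Real.cosh u
  set b := Real.cosh v
  set c := Real.cosh l
  have e1 : a + c ^ 2 / a - (b + c ^ 2 / b) = -((a - b) * (c ^ 2 - a * b) / (a * b)) := by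
    field_simp; ring
  have e2 : a + c ^ 2 / a + (b + c ^ 2 / b) = (a + b) * (c ^ 2 + a * b) / (a * b) := by
    field_simp; ring
  rw [e1, e2, abs_neg, abs_div, abs_mul, abs_of_pos (mul_pos p1 p2)]
  field_simp

theorem BHx_factor (l u v : ℝ) (hu0 : 0 ≤ u) (hul : u ≤ l) (hv0 : 0 < v) (hvl : v < l)
    (huv : u ≠ v) :
    |BHx l u - BHx l v| / (BHx l u + BHx l v) ≤
      Real.exp (-(BHg |u - v| + BHg (u + v) + BHg (2 * l - u - v))) := by
  rw [BHx_ratio, BH_cosh_ratio' u v hu0 hv0.le huv, neg_add, neg_add, Real.exp_add, Real.exp_add]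
  refine mul_le_mul_of_nonneg_left ?_ (by positivity)
  rw [BHg_exp _ (by linarith)]
  have key : ∀ t, 0 ≤ t → t ≤ l → Real.cosh l * Real.exp (t - l) ≤ Real.cosh t := by
    intro t ht htl
    rw [Real.cosh_eq, Real.cosh_eq]
    have : (Real.exp l + Real.exp (-l)) / 2 * Real.exp (t - l) =
        (Real.exp t + Real.exp (t - 2 * l)) / 2 := by
      rw [div_mul_eq_mul_div, add_mul, ← Real.exp_add, ← Real.exp_add]; ring_nf
    rw [this]
    have : Real.exp (t - 2 * l) ≤ Real.exp (-t) := Real.exp_le_exp.2 (by linarith)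
    linarith
  have k1 := key u hu0 hul
  have k2 := key v hv0.le hvl.le
  have p1 := Real.cosh_pos u
  have p2 := Real.cosh_pos v
  have p3 := Real.cosh_pos l
  have c1 : Real.cosh u ≤ Real.cosh l := by
    rw [Real.cosh_le_cosh, abs_of_nonneg hu0, abs_of_nonneg (by linarith)]; exact hul
  have c2 : Real.cosh v ≤ Real.cosh l := by
    rw [Real.cosh_le_cosh, abs_of_nonneg hv0.le, abs_of_nonneg (by linarith)]; exact hvl.le
  have hD : Real.cosh u * Real.cosh v ≤ Real.cosh l ^ 2 := by nlinarith
  rw [abs_of_nonneg (by linarith)]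
  have hE : Real.cosh l ^ 2 * Real.exp (-(2 * l - u - v)) ≤ Real.cosh u * Real.cosh v := by
    calc Real.cosh l ^ 2 * Real.exp (-(2 * l - u - v))
        = (Real.cosh l * Real.exp (u - l)) * (Real.cosh l * Real.exp (v - l)) := by
          rw [mul_mul_mul_comm, ← Real.exp_add]; ring_nf
      _ ≤ _ := mul_le_mul k1 k2 (by positivity) p1.le
  have hp := Real.exp_pos (-(2 * l - u - v))
  rw [div_le_div_iff₀ (by positivity) (by positivity)]
  nlinarith

theorem BHx_inj (l u v : ℝ) (hu0 : 0 ≤ u) (hul : u < l) (hv0 : 0 ≤ v) (hvl : v < l)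
    (h : BHx l u = BHx l v) : u = v := by
  have hr := BHx_ratio l u v
  rw [h, sub_self, abs_zero, zero_div] at hr
  have p1 := Real.cosh_pos u
  have p2 := Real.cosh_pos v
  have c1 : Real.cosh u < Real.cosh l := by
    rw [Real.cosh_lt_cosh, abs_of_nonneg hu0, abs_of_nonneg (by linarith)]; exact hul
  have c2 : Real.cosh v < Real.cosh l := by
    rw [Real.cosh_lt_cosh, abs_of_nonneg hv0, abs_of_nonneg (by linarith)]; exact hvl
  have hD : Real.cosh u * Real.cosh v < Real.cosh l ^ 2 := by nlinarith
  have h2 : 0 < |Real.cosh l ^ 2 - Real.cosh u * Real.cosh v| /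
      (Real.cosh l ^ 2 + Real.cosh u * Real.cosh v) := by
    apply div_pos (abs_pos.2 (by linarith)) (by positivity)
  have h3 := (mul_eq_zero.1 hr.symm).resolve_right h2.ne'
  have h4 : Real.cosh u - Real.cosh v = 0 := by
    rw [← abs_eq_zero]
    exact (div_eq_zero_iff.1 h3).resolve_right (by positivity)
  have h5 : Real.cosh u = Real.cosh v := by linarith
  have := Real.cosh_abs u
  rcases lt_trichotomy u v with h | h | h
  · have : Real.cosh u < Real.cosh v := by
      rw [Real.cosh_lt_cosh, abs_of_nonneg hu0, abs_of_nonneg hv0]; exact h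
    linarith
  · exact h
  · have : Real.cosh v < Real.cosh u := by
      rw [Real.cosh_lt_cosh, abs_of_nonneg hu0, abs_of_nonneg hv0]; exact h
    linarith

/-- Near-optimal nodes for the Zolotarev problem. -/
theorem BH_nodes (n : ℕ) (hn : 0 < n) (l : ℝ) (hl : 0 < l) :
    ∃ X : Fin n → ℝ, Function.Injective X ∧ (∀ i, 0 < X i) ∧
      ∀ w ∈ Set.Icc (2 * Real.cosh l) (1 + Real.cosh l ^ 2),
        ∏ i, (|w - X i| / (w + X i)) ≤
          Real.exp (1 - n * Real.pi ^ 2 / (2 * l) *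
            (1 - (Real.exp (-l) + Real.exp (-(2 * l))) / 2)) := by
  have hn' : (0:ℝ) < n := by exact_mod_cast hn
  set h := l / n with hh
  have hpos : 0 < h := by positivity
  have hnh : n * h = l := by rw [hh]; field_simp
  have hv : ∀ j < n, 0 < ((j:ℝ) + 1 / 2) * h ∧ ((j:ℝ) + 1 / 2) * h < l := by
    intro j hj
    refine ⟨by positivity, ?_⟩
    rw [← hnh]
    apply mul_lt_mul_of_pos_right _ hpos
    have : (j:ℝ) + 1 ≤ n := by exact_mod_cast hj
    linarith
  refine ⟨fun j => BHx l ((j + 1 / 2) * h), ?_, fun i => BHx_pos _ _, ?_⟩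
  · intro i j hij
    have h1 := hv i i.2
    have h2 := hv j j.2
    have h3 := BHx_inj l _ _ h1.1.le h1.2 h2.1.le h2.2 hij
    have h4 := mul_right_cancel₀ hpos.ne' h3
    have h5 : ((i : ℕ) : ℝ) = (j : ℕ) := by linarith
    exact Fin.ext (by exact_mod_cast h5)
  · intro w hw
    have hcont : ContinuousOn (BHx l) (Set.Icc 0 l) := by
      unfold BHx
      apply Continuous.continuousOn
      exact Real.continuous_cosh.add (continuous_const.div Real.continuous_cosh
        (fun x => (Real.cosh_pos x).ne'))
    have e0 : BHx l 0 = 1 + Real.cosh l ^ 2 := by simp [BHx]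
    have el : BHx l l = 2 * Real.cosh l := by
      have := Real.cosh_pos l
      unfold BHx; field_simp; ring
    obtain ⟨u, ⟨hu0, hul⟩, rfl⟩ := intermediate_value_Icc' hl.le hcont (by rw [e0, el]; exact hw)
    by_cases hex : ∃ j : Fin n, u = ((j:ℕ) + 1 / 2 : ℝ) * h
    · obtain ⟨j, hj⟩ := hex
      rw [Finset.prod_eq_zero (Finset.mem_univ j)]
      · positivity
      · show |BHx l u - BHx l (((j:ℕ) + 1 / 2 : ℝ) * h)| / _ = 0
        rw [← hj]; simp
    · push Not at hex
      have hg := BH_grid_lower n hn h u hpos hu0 (by rw [hnh]; exact hul)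
        (fun j hj => hex ⟨j, hj⟩)
      rw [hnh] at hg
      calc ∏ i : Fin n, (|BHx l u - BHx l ((i + 1 / 2) * h)| / (BHx l u + BHx l ((i + 1 / 2) * h)))
          ≤ ∏ i : Fin n, Real.exp (-(BHg |u - (i + 1 / 2) * h| + BHg (u + (i + 1 / 2) * h) +
              BHg (2 * l - u - (i + 1 / 2) * h))) := by
            refine Finset.prod_le_prod (fun i _ => ?_) (fun i _ => ?_)
            · have := BHx_pos l u
              have := BHx_pos l ((i + 1 / 2) * h)
              positivity
            · exact BHx_factor l u _ hu0 hul (hv i i.2).1 (hv i i.2).2 (hex i)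
        _ = Real.exp (-∑ j ∈ range n, (BHg |u - (j + 1 / 2) * h| + BHg (u + (j + 1 / 2) * h) +
              BHg (2 * l - u - (j + 1 / 2) * h))) := by
            rw [← Real.exp_sum, Finset.sum_neg_distrib, Finset.sum_range]
        _ ≤ _ := by
            apply Real.exp_le_exp.2
            have : Real.pi ^ 2 / (2 * h) = n * Real.pi ^ 2 / (2 * l) := by
              rw [hh]; field_simp
            rw [this] at hg
            linarith


theorem BH_riemann (τ x : ℝ) (hτ : 0 < τ) (hx : 0 < x) (N : ℕ) :
    ∑ k : Fin N, τ * Real.exp (-((k:ℕ) + 1 : ℝ) * τ * x) ≤ 1 / x ∧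
    (1 ≤ x → 1 / x - (τ + Real.exp (-(N * τ))) ≤
      ∑ k : Fin N, τ * Real.exp (-((k:ℕ) + 1 : ℝ) * τ * x)) := by
  set q := Real.exp (-(τ * x)) with hq
  have hq0 : 0 < q := Real.exp_pos _
  have htx : 0 < τ * x := by positivity
  have hq1 : q < 1 := by rw [hq, Real.exp_lt_one_iff]; linarith
  have hql : 1 - τ * x ≤ q := by
    have := Real.add_one_le_exp (-(τ * x)); rw [← hq] at this; linarith
  have hqu : q * (1 + τ * x) ≤ 1 := by
    have h1 := Real.add_one_le_exp (τ * x)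
    have h2 : q * Real.exp (τ * x) = 1 := by rw [hq, ← Real.exp_add]; simp
    nlinarith
  have hs : ∑ k : Fin N, τ * Real.exp (-((k:ℕ) + 1 : ℝ) * τ * x)
      = τ * q * ∑ k ∈ range N, q ^ k := by
    rw [Fin.sum_univ_eq_sum_range (fun k => τ * Real.exp (-((k:ℕ) + 1 : ℝ) * τ * x)) N,
      Finset.mul_sum]
    refine Finset.sum_congr rfl (fun k _ => ?_)
    rw [mul_assoc τ, ← pow_succ', hq, ← Real.exp_nat_mul]
    congr 2; push_cast; ring
  rw [hs]
  set G := ∑ k ∈ range N, q ^ k with hG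
  have hG0 : 0 ≤ G := Finset.sum_nonneg (fun _ _ => by positivity)
  have hg : (1 - q) * G = 1 - q ^ N := mul_neg_geom_sum q N
  have hqN : 0 < q ^ N := by positivity
  constructor
  · rw [le_div_iff₀ hx]
    nlinarith [mul_le_mul_of_nonneg_right hqu hG0]
  · intro hx1
    have hqN' : q ^ N ≤ Real.exp (-(N * τ)) := by
      rw [hq, ← Real.exp_nat_mul, Real.exp_le_exp]
      have : (N:ℝ) * τ * 1 ≤ N * τ * x := by gcongr
      linarith
    have h1 : 1 - q ^ N ≤ τ * x * G := by rw [← hg]; gcongr; linarith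
    have h2 : q * (1 - q ^ N) ≤ τ * q * G * x := by nlinarith
    have h3 : 1 - τ * x - q ^ N ≤ q * (1 - q ^ N) := by nlinarith [pow_pos hq0 N]
    have h4 : q ^ N ≤ Real.exp (-(N * τ)) * x := by
      nlinarith [Real.exp_pos (-(N * τ))]
    have : 1 / x ≤ τ * q * G + (τ + Real.exp (-(N * τ))) := by
      rw [div_le_iff₀ hx]; nlinarith
    linarith

theorem BH_exponent (M : ℝ) (hM : 1 < M) : 0 < Real.log (80 * M / 13) ∧
    1 / Real.log (8 * M) ≤ 1 / Real.log (80 * M / 13) *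
      (1 - (Real.exp (-Real.log (80 * M / 13)) + Real.exp (-(2 * Real.log (80 * M / 13)))) / 2) := by
  set E := 80 * M / 13 with hE
  have hE6 : 80 / 13 < E := by rw [hE]; linarith
  have hE0 : 0 < E := by linarith
  have hl : 0 < Real.log E := Real.log_pos (by linarith)
  refine ⟨hl, ?_⟩
  have e1 : Real.exp (-Real.log E) = 1 / E := by rw [Real.exp_neg, Real.exp_log hE0]; simp
  have e2 : Real.exp (-(2 * Real.log E)) = 1 / E * (1 / E) := by
    rw [← e1, ← Real.exp_add]; congr 1; ring
  rw [e1, e2]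
  have hsum : Real.log (8 * M) = Real.log E + Real.log (13 / 10) := by
    rw [← Real.log_mul hE0.ne' (by norm_num)]; congr 1; rw [hE]; ring
  have hσ : (3:ℝ) / 13 ≤ Real.log (13 / 10) := by
    have := Real.one_sub_inv_le_log_of_pos (show (0:ℝ) < 13 / 10 by norm_num)
    norm_num at this ⊢; linarith
  have hlogE : Real.log E ≤ E / 7 + 1 := by
    have h := Real.add_one_le_exp (Real.log E - 2)
    have he : Real.exp (Real.log E - 2) = E / Real.exp 2 := by
      rw [Real.exp_sub, Real.exp_log hE0]
    have h7 : (7:ℝ) ≤ Real.exp 2 := by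
      have h1 := Real.exp_one_gt_d9
      have : Real.exp 2 = Real.exp 1 * Real.exp 1 := by rw [← Real.exp_add]; norm_num
      nlinarith
    have : E / Real.exp 2 ≤ E / 7 := by gcongr
    linarith
  rw [hsum]
  set L := Real.log E
  set σ := Real.log (13 / 10)
  have hu : 1 / E ≤ 13 / 80 := by
    rw [div_le_div_iff₀ hE0 (by norm_num)]; linarith
  have hu0 : 0 < 1 / E := by positivity
  have huE : 1 / E * E = 1 := by field_simp
  set u := 1 / E
  rw [div_mul_eq_mul_div, one_mul, div_le_div_iff₀ (by linarith) hl, one_mul]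
  have k1 : (u + u * u) / 2 ≤ 93 / 160 * u := by nlinarith
  have k2 : u * L ≤ 1 / 7 + u := by nlinarith
  have k3 : (1 - 93 / 160 * u) * (L + σ) ≤ (1 - (u + u * u) / 2) * (L + σ) := by
    gcongr
  refine le_trans ?_ k3
  nlinarith [mul_le_mul hu hσ (by norm_num) (by norm_num)]


/-- Nodes in the shifted variable. -/
theorem BH_nodes_scaled (M : ℝ) (hM : 1 < M) (R : ℕ) (hR : 0 < R) :
    ∃ d : Fin (2 * R) → ℝ, Function.Injective d ∧ (∀ i, 0 < d i) ∧
      ∀ x ∈ Set.Icc (1 : ℝ) M, ∏ i, (|(x - 7 / 20) - d i| / ((x - 7 / 20) + d i)) ≤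
        Real.exp 1 * Real.exp (-(R : ℝ) * Real.pi ^ 2 / Real.log (8 * M)) := by
  obtain ⟨hl, hexp⟩ := BH_exponent M hM
  have hel : Real.exp (Real.log (80 * M / 13)) = 80 * M / 13 := Real.exp_log (by linarith)
  set l := Real.log (80 * M / 13) with hldef
  obtain ⟨X, hXi, hXp, hX⟩ := BH_nodes (2 * R) (by omega) l hl
  have hc := Real.cosh_pos l
  have hce : 40 * M / 13 ≤ Real.cosh l := by
    rw [Real.cosh_eq, hel]; have := Real.exp_pos (-l); linarith
  set c := Real.cosh l with hcdef
  set κ : ℝ := 13 / 20 / (2 * c) with hκ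
  have hκ0 : 0 < κ := by positivity
  refine ⟨fun i => κ * X i, ?_, fun i => mul_pos hκ0 (hXp i), ?_⟩
  · intro i j hij
    exact hXi (mul_left_cancel₀ hκ0.ne' hij)
  · intro x hx
    obtain ⟨hx1, hxM⟩ := hx
    set w := (x - 7 / 20) / κ with hw
    have hwx : x - 7 / 20 = κ * w := by rw [hw]; field_simp
    have hκc : κ * (2 * c) = 13 / 20 := by rw [hκ]; field_simp
    have hmem : w ∈ Set.Icc (2 * c) (1 + c ^ 2) := by
      constructor
      · rw [hw, le_div_iff₀ hκ0]; linarith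
      · rw [hw, div_le_iff₀ hκ0]
        have : (1 + c ^ 2) * κ = κ + 13 / 40 * c := by nlinarith
        rw [this]; linarith
    have hp := hX w hmem
    calc ∏ i, (|(x - 7 / 20) - κ * X i| / ((x - 7 / 20) + κ * X i))
        = ∏ i, (|w - X i| / (w + X i)) := by
          refine Finset.prod_congr rfl (fun i _ => ?_)
          rw [hwx, ← mul_sub, ← mul_add, abs_mul, abs_of_pos hκ0,
            mul_div_mul_left _ _ hκ0.ne']
      _ ≤ _ := hp
      _ ≤ _ := by
        rw [← Real.exp_add, Real.exp_le_exp]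
        have hpos : (0:ℝ) ≤ R * Real.pi ^ 2 := by positivity
        have := mul_le_mul_of_nonneg_left hexp hpos
        have e1 : ((2 * R : ℕ) : ℝ) * Real.pi ^ 2 / (2 * l) *
            (1 - (Real.exp (-l) + Real.exp (-(2 * l))) / 2) =
            R * Real.pi ^ 2 * (1 / l * (1 - (Real.exp (-l) + Real.exp (-(2 * l))) / 2)) := by
          push_cast; field_simp
        have e2 : -(R : ℝ) * Real.pi ^ 2 / Real.log (8 * M) =
          -(R * Real.pi ^ 2 * (1 / Real.log (8 * M))) := by ring
        rw [e1, e2]; linarith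

theorem BH_core (M : ℝ) (hM : 1 < M) (R : ℕ) (hR : 0 < R) (τ : ℝ) (hτ : 0 < τ) (N : ℕ) :
    ∃ (S : Finset ℝ) (V : ℝ → ℝ), S.card ≤ R ∧ (∀ s ∈ S, 0 < s ∧ 0 < V s) ∧
      ∀ x ∈ Set.Icc (1 : ℝ) M,
        |∑ k : Fin N, τ * Real.exp (-((k:ℕ) + 1 : ℝ) * τ * x) - ∑ s ∈ S, V s * Real.exp (-s * x)|
          ≤ 40 / 7 * (Real.exp 1 * Real.exp (-(R : ℝ) * Real.pi ^ 2 / Real.log (8 * M))) := by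
  obtain ⟨d, hdi, hdp, hd⟩ := BH_nodes_scaled M hM R hR
  set p0 : (Fin N → ℝ) × (Fin N → ℝ) :=
    (fun k => Real.sqrt (τ * Real.exp (-((k:ℕ) + 1 : ℝ) * τ * (7 / 20))),
     fun k => Real.sqrt ((k:ℕ) * τ)) with hp0
  have hphi : ∀ y : ℝ, BHphi τ y p0 =
      ∑ k : Fin N, τ * Real.exp (-((k:ℕ) + 1 : ℝ) * τ * (7 / 20 + y)) := by
    intro y
    unfold BHphi
    refine Finset.sum_congr rfl (fun k _ => ?_)
    simp only [hp0]
    rw [Real.sq_sqrt (by positivity), Real.sq_sqrt (by positivity), mul_assoc, ← Real.exp_add]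
    congr 2; ring
  obtain ⟨S, W, hcard, hS, hinterp, hW⟩ := BH_reduce R d hdi hdp τ p0
  have hphi0 : BHphi τ 0 p0 ≤ 20 / 7 := by
    rw [hphi 0]
    have := (BH_riemann τ (7 / 20 + 0) hτ (by norm_num) N).1
    norm_num at this ⊢; linarith
  refine ⟨S, fun s => W s * Real.exp (s * (7 / 20)), hcard, fun s hs => ⟨?_, ?_⟩, ?_⟩
  · linarith [(hS s hs).1]
  · exact mul_pos (hS s hs).2 (Real.exp_pos _)
  intro x hx
  have hx1 := hx.1
  set f : ℂ → ℂ := fun z =>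
    ∑ k, ((p0.1 k ^ 2 : ℝ) : ℂ) * Complex.exp (((-(τ + p0.2 k ^ 2) : ℝ) : ℂ) * z) -
      ∑ s ∈ S, ((W s : ℝ) : ℂ) * Complex.exp (((-s : ℝ) : ℂ) * z) with hf
  have hfreal : ∀ y : ℝ, f y = ((BHphi τ y p0 - ∑ s ∈ S, W s * Real.exp (-s * y) : ℝ) : ℂ) := by
    intro y
    simp only [hf, BHphi]
    push_cast
    rfl
  have hterm : ∀ (c a : ℝ) (z : ℂ), 0 ≤ c → 0 ≤ a → 0 ≤ z.re →
      ‖(c : ℂ) * Complex.exp (((-a : ℝ) : ℂ) * z)‖ ≤ c := by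
    intro c a z hc ha hz
    rw [norm_mul, Complex.norm_exp, Complex.norm_real, Real.norm_of_nonneg hc,
      Complex.re_ofReal_mul]
    have : Real.exp (-a * z.re) ≤ 1 := by
      rw [Real.exp_le_one_iff]; nlinarith
    nlinarith
  have hbd : ∀ z : ℂ, 0 ≤ z.re → ‖f z‖ ≤ 40 / 7 := by
    intro z hz
    have h1 : ‖∑ k, ((p0.1 k ^ 2 : ℝ) : ℂ) * Complex.exp (((-(τ + p0.2 k ^ 2) : ℝ) : ℂ) * z)‖
        ≤ BHphi τ 0 p0 := by
      refine (norm_sum_le _ _).trans ?_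
      unfold BHphi
      refine Finset.sum_le_sum (fun k _ => ?_)
      rw [mul_zero, Real.exp_zero, mul_one]
      exact hterm _ _ z (by positivity) (by positivity) hz
    have h2 : ‖∑ s ∈ S, ((W s : ℝ) : ℂ) * Complex.exp (((-s : ℝ) : ℂ) * z)‖ ≤ BHphi τ 0 p0 := by
      refine ((norm_sum_le _ _).trans ?_).trans hW
      refine Finset.sum_le_sum (fun s hs => ?_)
      exact hterm _ _ z (hS s hs).2.le (by linarith [(hS s hs).1]) hz
    calc ‖f z‖ ≤ _ := norm_sub_le _ _
      _ ≤ 40 / 7 := by linarith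
  have hdiff : Differentiable ℂ f := by
    rw [hf]; fun_prop
  have hzero : ∀ i, f (d i) = 0 := by
    intro i
    rw [hfreal, hinterp i]; simp
  have hB := BH_blaschke (2 * R) d hdi hdp f hdiff (40 / 7) hbd hzero (x - 7 / 20) (by linarith)
  rw [hfreal, Complex.norm_real, Real.norm_eq_abs, hphi] at hB
  have hd' := hd x hx
  have e : ∑ s ∈ S, W s * Real.exp (s * (7 / 20)) * Real.exp (-s * x)
      = ∑ s ∈ S, W s * Real.exp (-s * (x - 7 / 20)) := by
    refine Finset.sum_congr rfl (fun s _ => ?_)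
    rw [mul_assoc, ← Real.exp_add]; congr 2; ring
  simp only [e]
  rw [show (7 / 20 + (x - 7 / 20) : ℝ) = x by ring] at hB
  exact hB.trans (by gcongr)

theorem BH_pad (S : Finset ℝ) (V : ℝ → ℝ) (R : ℕ) (hcard : S.card ≤ R)
    (hS : ∀ s ∈ S, 0 < s ∧ 0 < V s) (η : ℝ) (hη : 0 < η) :
    ∃ ω α : Fin R → ℝ, (∀ j, 0 < ω j) ∧ (∀ j, 0 < α j) ∧
      ∀ x : ℝ, 0 ≤ x → |∑ s ∈ S, V s * Real.exp (-s * x) - ∑ j, ω j * Real.exp (-α j * x)|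
        ≤ R * η := by
  obtain ⟨m, rfl⟩ := Nat.exists_eq_add_of_le hcard
  set e := S.equivFin
  refine ⟨Fin.append (fun i => V (e.symm i)) (fun _ => η), Fin.append (fun i => (e.symm i : ℝ)) (fun _ => 1),
    ?_, ?_, ?_⟩
  · intro j
    refine Fin.addCases (fun i => ?_) (fun i => ?_) j
    · rw [Fin.append_left]; exact (hS _ (e.symm i).2).2
    · rw [Fin.append_right]; exact hη
  · intro j
    refine Fin.addCases (fun i => ?_) (fun i => ?_) j
    · rw [Fin.append_left]; exact (hS _ (e.symm i).2).1
    · rw [Fin.append_right]; exact one_pos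
  · intro x hx
    rw [Fin.sum_univ_add]
    simp only [Fin.append_left, Fin.append_right]
    have h1 : ∑ i : Fin S.card, V (e.symm i) * Real.exp (-(e.symm i : ℝ) * x)
        = ∑ s ∈ S, V s * Real.exp (-s * x) := by
      rw [← Finset.sum_coe_sort S (fun s => V s * Real.exp (-s * x))]
      exact Equiv.sum_comp e.symm (fun s : S => V s * Real.exp (-(s:ℝ) * x))
    rw [h1]
    have h2 : Real.exp (-1 * x) ≤ 1 := by rw [Real.exp_le_one_iff]; linarith
    have h3 := Real.exp_pos (-1 * x)
    rw [sub_add_cancel_left, abs_neg, Finset.sum_const, Finset.card_univ, Fintype.card_fin,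
      nsmul_eq_mul, abs_of_nonneg (by positivity)]
    have h4 : η * Real.exp (-1 * x) ≤ η := by nlinarith
    push_cast
    have : (0:ℝ) ≤ S.card := by positivity
    nlinarith [mul_le_mul_of_nonneg_left h4 (Nat.cast_nonneg (α := ℝ) m)]

/-- Braess–Hackbusch exponential sum approximation of `1/λ` on `[1, M]`: there exist positive
weights `ω_j` and exponents `α_j` such that
`sup_{λ∈[1,M]} |1/λ − Σ_{j=1}^R ω_j exp(−α_j λ)| ≤ 16 exp(−R π² / log(8M))`. -/
theorem braess_hackbusch_exp_sum (M : ℝ) (hM : 1 < M) (R : ℕ) :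
    ∃ ω α : Fin R → ℝ, (∀ j, 0 < ω j) ∧ (∀ j, 0 < α j) ∧
      ∀ l ∈ Set.Icc (1 : ℝ) M,
        |1 / l - ∑ j, ω j * Real.exp (-α j * l)|
          ≤ 16 * Real.exp (-(R : ℝ) * Real.pi ^ 2 / Real.log (8 * M)) := by
  rcases Nat.eq_zero_or_pos R with rfl | hR
  · refine ⟨fun _ => 1, fun _ => 1, fun _ => one_pos, fun _ => one_pos, ?_⟩
    intro l hl
    have hl1 := hl.1
    have h1 : 1 / l ≤ 1 := by rw [div_le_one (by linarith)]; exact hl1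
    have h0 : 0 ≤ 1 / l := by positivity
    simp only [Finset.univ_eq_empty, Finset.sum_empty, sub_zero, Nat.cast_zero, neg_zero,
      zero_mul, zero_div, Real.exp_zero]
    rw [abs_of_nonneg h0]; linarith
  · set ε := Real.exp (-(R : ℝ) * Real.pi ^ 2 / Real.log (8 * M)) with hε
    have hε0 : 0 < ε := Real.exp_pos _
    have hR' : (0:ℝ) < R := by exact_mod_cast hR
    have hτ : 0 < ε / 10 := by positivity
    obtain ⟨N, hN⟩ := exists_nat_gt (-Real.log (ε / 10) / (ε / 10))
    have hN' : Real.exp (-(N * (ε / 10))) ≤ ε / 10 := by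
      rw [← Real.le_log_iff_exp_le hτ]
      rw [div_lt_iff₀ hτ] at hN
      linarith
    obtain ⟨S, V, hcard, hS, hb⟩ := BH_core M hM R hR (ε / 10) hτ N
    obtain ⟨ω, α, hω, hα, hpad⟩ := BH_pad S V R hcard hS (ε / 10 / R) (by positivity)
    refine ⟨ω, α, hω, hα, fun l hl => ?_⟩
    have hl1 := hl.1
    have h1 := hb l hl
    have h2 := hpad l (by linarith)
    rw [mul_div_cancel₀ _ hR'.ne'] at h2
    obtain ⟨h3, h4⟩ := BH_riemann (ε / 10) l hτ (by linarith) N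
    have h4 := h4 hl1
    have he := Real.exp_one_lt_d9
    have h5 : Real.exp 1 * ε ≤ 2.72 * ε := by
      gcongr; norm_num at he ⊢; linarith
    rw [abs_le] at h1 h2 ⊢
    constructor <;> linarith [h1.1, h1.2, h2.1, h2.2]
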